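/- For all natural numbers w, h and every p ≥ 1, the number of non-ambiguous trees of nonempty shape having exactly w left children, h right children, and whose underlying binary tree has hook number p, equals (p−1)! · p! · S(w+1, p) · S(h+1, p), where S(n,p) is the Stirling number of the second kind. -/

import Mathlib

inductive BT : Type where
  | nil : BT
  | node : BT → BT → BT
  deriving DecidableEq

namespace BT

/-- The list of positions (paths from the root, `false` = left step, `true` = right step)
of the vertices of a binary tree. -/
def paths : BT → List (List Bool)
  | .nil => []
  | .node l r => [] :: (l.paths.map (List.cons false) ++ r.paths.map (List.cons true))

/-- Number of vertices. -/
def size (B : BT) : ℕ := B.paths.length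

/-- The set of left children (positions ending with a left step). -/
def leftVertices (B : BT) : Finset (List Bool) :=
  B.paths.toFinset.filter (fun p => p.getLast? = some false)

/-- The set of right children (positions ending with a right step). -/
def rightVertices (B : BT) : Finset (List Bool) :=
  B.paths.toFinset.filter (fun p => p.getLast? = some true)

end BT

/-- A non-ambiguous tree of shape `B`: bijective labellings of the left (resp. right)
children by `Fin |LV B|` (resp. `Fin |RV B|`), decreasing along ancestry. -/
structure NAT (B : BT) where
  fL : {p // p ∈ B.leftVertices} → Fin B.leftVertices.card
  fR : {p // p ∈ B.rightVertices} → Fin B.rightVertices.card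
  bijL : Function.Bijective fL
  bijR : Function.Bijective fR
  ancL : ∀ u v : {p // p ∈ B.leftVertices}, u.1 <+: v.1 → u ≠ v → (fL v : ℕ) < fL u
  ancR : ∀ u v : {p // p ∈ B.rightVertices}, u.1 <+: v.1 → u ≠ v → (fR v : ℕ) < fR u

namespace BT

mutual
  /-- The hook number of a binary tree: the number of blocks when the vertices are
  partitioned by repeatedly extracting the hook (root + left spine + right spine)
  of the root of each remaining subtree. -/
  def hookNum : BT → ℕ
    | .nil => 0
    | .node l r => 1 + hookNumL l + hookNumR r
  /-- Sum of the hook numbers of the subtrees hanging to the right of the left spine. -/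
  def hookNumL : BT → ℕ
    | .nil => 0
    | .node l r => hookNumL l + hookNum r
  /-- Sum of the hook numbers of the subtrees hanging to the left of the right spine. -/
  def hookNumR : BT → ℕ
    | .nil => 0
    | .node l r => hookNum l + hookNumR r
end

end BT

/-- Stirling numbers of the second kind: `stirling2 n p` is the number of partitions of an
`n`-element set into `p` nonempty blocks (via the standard recurrence). -/
def stirling2 : ℕ → ℕ → ℕ
  | 0, 0 => 1
  | 0, _ + 1 => 0
  | _ + 1, 0 => 0
  | n + 1, p + 1 => (p + 1) * stirling2 n (p + 1) + stirling2 n p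


namespace HookSeries

open PowerSeries (coeff)

/-- The polynomial ring `ℚ[x, y, t]`, with variables indexed by `0`, `1`, `2`. -/
abbrev Poly : Type := MvPolynomial (Fin 3) ℚ

/-- The partial derivative with respect to the `i`-th variable, acting coefficientwise on power
series over `ℚ[x, y, t]`. -/
noncomputable def pd (i : Fin 3) : Derivation ℚ (PowerSeries Poly) (PowerSeries Poly) :=
  Derivation.mk'
    { toFun := fun f => PowerSeries.mk fun n => MvPolynomial.pderiv i (coeff n f)
      map_add' := fun f g => by ext1 n; simp
      map_smul' := fun c f => by ext1 n; simp }
    (fun f g => by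
      ext1 n
      simp [PowerSeries.coeff_mul, Finset.sum_add_distrib]
      rw [← Finset.Nat.sum_antidiagonal_swap]
      simp)

theorem coeff_pd (i : Fin 3) (f : PowerSeries Poly) (n : ℕ) :
    coeff n (pd i f) = MvPolynomial.pderiv i (coeff n f) := by
  simp [pd]

theorem pd_C (i : Fin 3) (a : Poly) :
    pd i (PowerSeries.C a) = PowerSeries.C (MvPolynomial.pderiv i a) := by
  ext1 n
  rw [coeff_pd, PowerSeries.coeff_C, PowerSeries.coeff_C]
  split_ifs <;> simp

/-- The substitution of `0` for the `i`-th variable. -/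
noncomputable def kill (i : Fin 3) : Poly →ₐ[ℚ] Poly :=
  MvPolynomial.aeval fun j => if j = i then 0 else MvPolynomial.X j

theorem kill_monomial (i : Fin 3) (s : Fin 3 →₀ ℕ) (c : ℚ) :
    kill i (MvPolynomial.monomial s c) = if s i = 0 then MvPolynomial.monomial s c else 0 := by
  rw [kill, MvPolynomial.aeval_monomial]
  split_ifs with h
  · rw [MvPolynomial.monomial_eq]
    congr 1
    refine Finsupp.prod_congr fun j hj => ?_
    rw [if_neg]
    rintro rfl
    simp [h] at hj
  · rw [Finsupp.prod, Finset.prod_eq_zero (Finsupp.mem_support_iff.2 h), mul_zero]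
    simp [h]

theorem coeff_kill (i : Fin 3) (f : Poly) (m : Fin 3 →₀ ℕ) (hm : m i = 0) :
    MvPolynomial.coeff m (kill i f) = MvPolynomial.coeff m f := by
  induction f using MvPolynomial.induction_on' with
  | monomial s c =>
    rw [kill_monomial]
    split_ifs with h
    · rfl
    · rw [MvPolynomial.coeff_monomial, if_neg, MvPolynomial.coeff_zero]
      rintro rfl
      exact h hm
  | add f g hf hg => simp [hf, hg]

theorem eq_of_pderiv_eq_of_kill_eq {i : Fin 3} {f g : Poly}
    (hd : MvPolynomial.pderiv i f = MvPolynomial.pderiv i g) (hk : kill i f = kill i g) :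
    f = g := by
  ext m
  by_cases hm : m i = 0
  · rw [← coeff_kill i f m hm, hk, coeff_kill i g m hm]
  · have key := congrArg (MvPolynomial.coeff (m - Finsupp.single i 1)) hd
    have hle : Finsupp.single i 1 ≤ m := by
      rw [Finsupp.single_le_iff]; omega
    rw [MvPolynomial.coeff_pderiv, MvPolynomial.coeff_pderiv, tsub_add_cancel_of_le hle] at key
    refine mul_right_cancel₀ ?_ key
    positivity

/-- The system of differential equations satisfied by the generating series of trees. -/
structure IsSolution (P Q U V : PowerSeries Poly) : Prop where
  pdP : pd 0 P = PowerSeries.X * (P * V)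
  pdQ : pd 1 Q = PowerSeries.X * (U * Q)
  pdU : pd 0 U = PowerSeries.X * (PowerSeries.C (MvPolynomial.X 2) * (P * Q))
  pdV : pd 1 V = PowerSeries.X * (PowerSeries.C (MvPolynomial.X 2) * (P * Q))
  killP : PowerSeries.map (kill 0 : Poly →+* Poly) P = 1
  killQ : PowerSeries.map (kill 1 : Poly →+* Poly) Q = 1
  killU : PowerSeries.map (kill 0 : Poly →+* Poly) U = 1
  killV : PowerSeries.map (kill 1 : Poly →+* Poly) V = 1

theorem coeff_eq_of_pd {i : Fin 3} {F G F' G' : PowerSeries Poly} {n : ℕ}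
    (hF : pd i F = PowerSeries.X * F') (hG : pd i G = PowerSeries.X * G')
    (kF : PowerSeries.map (kill i : Poly →+* Poly) F = 1)
    (kG : PowerSeries.map (kill i : Poly →+* Poly) G = 1)
    (h : ∀ m < n, coeff m F' = coeff m G') : coeff n F = coeff n G := by
  apply eq_of_pderiv_eq_of_kill_eq (i := i)
  · rw [← coeff_pd, ← coeff_pd, hF, hG]
    cases n with
    | zero => simp
    | succ n =>
      rw [PowerSeries.coeff_succ_X_mul, PowerSeries.coeff_succ_X_mul, h n (Nat.lt_succ_self n)]
  · simpa using congrArg (coeff n) (kF.trans kG.symm)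

theorem coeff_mul_congr {F G F' G' : PowerSeries Poly} {n : ℕ}
    (h : ∀ m ≤ n, coeff m F = coeff m F') (h' : ∀ m ≤ n, coeff m G = coeff m G') :
    coeff n (F * G) = coeff n (F' * G') := by
  rw [PowerSeries.coeff_mul, PowerSeries.coeff_mul]
  refine Finset.sum_congr rfl fun ij hij => ?_
  have hn := Finset.HasAntidiagonal.mem_antidiagonal.1 hij
  rw [h _ (by omega), h' _ (by omega)]

theorem IsSolution.unique {P Q U V P' Q' U' V' : PowerSeries Poly}
    (h : IsSolution P Q U V) (h' : IsSolution P' Q' U' V') : U = U' := by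
  have key : ∀ n, coeff n P = coeff n P' ∧ coeff n Q = coeff n Q' ∧ coeff n U = coeff n U' ∧
      coeff n V = coeff n V' := by
    intro n
    induction n using Nat.strong_induction_on with
    | _ n ih =>
      have eP : ∀ k < n, ∀ m ≤ k, coeff m P = coeff m P' := fun k hk m hm => (ih m (by omega)).1
      have eQ : ∀ k < n, ∀ m ≤ k, coeff m Q = coeff m Q' :=
        fun k hk m hm => (ih m (by omega)).2.1
      have eU : ∀ k < n, ∀ m ≤ k, coeff m U = coeff m U' :=
        fun k hk m hm => (ih m (by omega)).2.2.1
      have eV : ∀ k < n, ∀ m ≤ k, coeff m V = coeff m V' :=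
        fun k hk m hm => (ih m (by omega)).2.2.2
      have ePQ : ∀ k < n, coeff k (PowerSeries.C (MvPolynomial.X 2) * (P * Q)) =
          coeff k (PowerSeries.C (MvPolynomial.X 2) * (P' * Q')) := fun k hk => by
        rw [PowerSeries.coeff_C_mul, PowerSeries.coeff_C_mul,
          coeff_mul_congr (eP k hk) (eQ k hk)]
      exact ⟨coeff_eq_of_pd h.pdP h'.pdP h.killP h'.killP
          fun k hk => coeff_mul_congr (eP k hk) (eV k hk),
        coeff_eq_of_pd h.pdQ h'.pdQ h.killQ h'.killQ
          fun k hk => coeff_mul_congr (eU k hk) (eQ k hk),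
        coeff_eq_of_pd h.pdU h'.pdU h.killU h'.killU ePQ,
        coeff_eq_of_pd h.pdV h'.pdV h.killV h'.killV ePQ⟩
  exact PowerSeries.ext fun n => (key n).2.2.1

/-- The series `exp (z * x_i) - 1`. -/
noncomputable def expSubOne (i : Fin 3) : PowerSeries Poly :=
  PowerSeries.rescale (MvPolynomial.X i) (PowerSeries.exp Poly - 1)

theorem expSubOne_eq (i : Fin 3) :
    expSubOne i = PowerSeries.rescale (MvPolynomial.X i) (PowerSeries.exp Poly) - 1 := by
  simp [expSubOne]

theorem pd_expSubOne_self (i : Fin 3) :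
    pd i (expSubOne i) = PowerSeries.X * (1 + expSubOne i) := by
  rw [expSubOne_eq, map_sub, Derivation.map_one_eq_zero, sub_zero, add_sub_cancel]
  ext1 n
  rw [coeff_pd, PowerSeries.coeff_rescale, PowerSeries.coeff_exp]
  cases n with
  | zero => simp
  | succ n =>
    rw [PowerSeries.coeff_succ_X_mul, PowerSeries.coeff_rescale, PowerSeries.coeff_exp,
      MvPolynomial.algebraMap_eq, mul_comm, MvPolynomial.pderiv_C_mul, MvPolynomial.pderiv_pow,
      MvPolynomial.pderiv_X_self, mul_comm]
    have : (1 / (n.factorial : ℚ)) = ((n + 1 : ℕ) : ℚ) * (1 / ((n + 1).factorial : ℚ)) := by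
      rw [Nat.factorial_succ]
      push_cast
      field_simp
    rw [this, MvPolynomial.C_mul, map_natCast]
    simp only [add_tsub_cancel_right]
    ring

theorem pd_expSubOne_of_ne {i j : Fin 3} (h : j ≠ i) : pd i (expSubOne j) = 0 := by
  ext1 n
  rw [expSubOne, coeff_pd, PowerSeries.coeff_rescale, MvPolynomial.pderiv_mul,
    MvPolynomial.pderiv_pow, MvPolynomial.pderiv_X_of_ne h]
  simp only [mul_zero, zero_mul, zero_add, map_sub, PowerSeries.coeff_exp, PowerSeries.coeff_one,
    MvPolynomial.algebraMap_eq, MvPolynomial.pderiv_C]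
  split_ifs <;> simp

theorem map_kill_expSubOne (i : Fin 3) :
    PowerSeries.map (kill i : Poly →+* Poly) (expSubOne i) = 0 := by
  ext1 n
  rw [expSubOne, PowerSeries.coeff_map, PowerSeries.coeff_rescale]
  cases n with
  | zero => simp
  | succ n => simp [kill]

theorem constantCoeff_expSubOne (i : Fin 3) : PowerSeries.constantCoeff (expSubOne i) = 0 := by
  rw [← PowerSeries.coeff_zero_eq_constantCoeff_apply, expSubOne, PowerSeries.coeff_rescale]
  simp

/-- The series `1 / (1 - t (e^{zx} - 1) (e^{zy} - 1))`. -/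
noncomputable def geom : PowerSeries Poly :=
  PowerSeries.invOfUnit
    (1 - PowerSeries.C (MvPolynomial.X 2) * (expSubOne 0 * expSubOne 1)) 1

theorem mul_geom :
    (1 - PowerSeries.C (MvPolynomial.X 2) * (expSubOne 0 * expSubOne 1)) * geom = 1 := by
  apply PowerSeries.mul_invOfUnit
  simp [constantCoeff_expSubOne]

theorem pd_geom {i j : Fin 3} (hij : expSubOne 0 * expSubOne 1 = expSubOne i * expSubOne j)
    (h : j ≠ i) (h2 : 2 ≠ i) :
    pd i geom = PowerSeries.X * (PowerSeries.C (MvPolynomial.X 2) *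
      ((1 + expSubOne i) * expSubOne j * geom ^ 2)) := by
  have e := mul_geom
  rw [hij] at e
  have d := congrArg (pd i) e
  simp only [Derivation.leibniz, map_sub, Derivation.map_one_eq_zero, pd_C, pd_expSubOne_self,
    pd_expSubOne_of_ne h, MvPolynomial.pderiv_X_of_ne h2, smul_eq_mul, map_zero] at d
  set T : PowerSeries Poly := PowerSeries.C (MvPolynomial.X 2)
  linear_combination geom * d - pd i geom * e

theorem map_kill_geom {i j : Fin 3}
    (hij : expSubOne 0 * expSubOne 1 = expSubOne i * expSubOne j) :
    PowerSeries.map (kill i : Poly →+* Poly) geom = 1 := by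
  have e := congrArg (PowerSeries.map (kill i : Poly →+* Poly)) mul_geom
  rw [hij] at e
  simpa only [map_mul, map_sub, map_one, map_kill_expSubOne, zero_mul, mul_zero, sub_zero,
    one_mul] using e

theorem isSolution_geom :
    IsSolution ((1 + expSubOne 0) * geom) ((1 + expSubOne 1) * geom)
      ((1 + PowerSeries.C (MvPolynomial.X 2) * expSubOne 0) * geom)
      ((1 + PowerSeries.C (MvPolynomial.X 2) * expSubOne 1) * geom) := by
  have e := mul_geom
  have d0 := pd_geom (i := 0) (j := 1) rfl (by decide) (by decide)
  have d1 := pd_geom (i := 1) (j := 0) (mul_comm _ _) (by decide) (by decide)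
  have k0 := map_kill_geom (i := 0) (j := 1) rfl
  have k1 := map_kill_geom (i := 1) (j := 0) (mul_comm _ _)
  have t0 : MvPolynomial.pderiv (R := ℚ) (0 : Fin 3) (MvPolynomial.X 2) = 0 :=
    MvPolynomial.pderiv_X_of_ne (by decide)
  have t1 : MvPolynomial.pderiv (R := ℚ) (1 : Fin 3) (MvPolynomial.X 2) = 0 :=
    MvPolynomial.pderiv_X_of_ne (by decide)
  constructor
  any_goals
    simp only [map_mul, map_add, map_one, map_kill_expSubOne, k0, k1, mul_zero, add_zero, mul_one]
  all_goals
    simp only [Derivation.leibniz, map_add, Derivation.map_one_eq_zero, pd_C, t0, t1,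
      pd_expSubOne_self, d0, d1, smul_eq_mul, map_zero]
    set T : PowerSeries Poly := PowerSeries.C (MvPolynomial.X 2)
    set D := geom
    set A := expSubOne 0
    set B := expSubOne 1
    set z : PowerSeries Poly := PowerSeries.X
  · linear_combination (-z * (1 + A) * D) * e
  · linear_combination (-z * (1 + B) * D) * e
  · linear_combination (-z * T * (1 + A) * D) * e
  · linear_combination (-z * T * (1 + B) * D) * e

end HookSeries

theorem coeff_exp_sub_one_pow (n p : ℕ) :
    PowerSeries.coeff n ((PowerSeries.exp ℚ - 1) ^ p) =
      (p.factorial * stirling2 n p / n.factorial : ℚ) := by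
  induction n generalizing p with
  | zero =>
    cases p with
    | zero => simp [stirling2]
    | succ p => simp [stirling2]
  | succ n ih =>
    cases p with
    | zero => simp [stirling2, PowerSeries.coeff_one]
    | succ p =>
      have hd : PowerSeries.derivative ℚ ((PowerSeries.exp ℚ - 1) ^ (p + 1)) =
          (p + 1 : ℕ) • ((PowerSeries.exp ℚ - 1) ^ p + (PowerSeries.exp ℚ - 1) ^ (p + 1)) := by
        rw [Derivation.leibniz_pow, map_sub, Derivation.map_one_eq_zero,
          PowerSeries.derivative_exp, sub_zero, add_tsub_cancel_right, smul_eq_mul]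
        ring
      have hc := congrArg (PowerSeries.coeff n) hd
      rw [PowerSeries.coeff_derivative, map_nsmul, map_add, ih, ih, nsmul_eq_mul] at hc
      have hn : (n + 1 : ℚ) ≠ 0 := by positivity
      rw [eq_div_of_mul_eq hn hc, stirling2, Nat.factorial_succ n, Nat.factorial_succ p]
      push_cast
      field_simp
      ring

namespace HookSeries

open PowerSeries (coeff)

/-- The exponent of the monomial `x ^ i * y ^ j * t ^ k`. -/
noncomputable def expo (i j k : ℕ) : Fin 3 →₀ ℕ :=
  Finsupp.single 0 i + Finsupp.single 1 j + Finsupp.single 2 k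

theorem expo_zero (i j k : ℕ) : expo i j k 0 = i := by simp [expo]

theorem expo_one (i j k : ℕ) : expo i j k 1 = j := by simp [expo]

theorem expo_two (i j k : ℕ) : expo i j k 2 = k := by simp [expo]

theorem expo_inj {i j k i' j' k' : ℕ} :
    expo i j k = expo i' j' k' ↔ i = i' ∧ j = j' ∧ k = k' := by
  refine ⟨fun h => ⟨?_, ?_, ?_⟩, fun ⟨h, h', h''⟩ => by rw [h, h', h'']⟩
  · rw [← expo_zero i j k, h, expo_zero]
  · rw [← expo_one i j k, h, expo_one]
  · rw [← expo_two i j k, h, expo_two]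

theorem expo_add (i j k i' j' k' : ℕ) :
    expo i j k + expo i' j' k' = expo (i + i') (j + j') (k + k') := by
  simp only [expo, Finsupp.single_add]
  abel

theorem coeff_expSubOne_pow (i : Fin 3) (n p : ℕ) :
    coeff n (expSubOne i ^ p) =
      MvPolynomial.monomial (Finsupp.single i n) (coeff n ((PowerSeries.exp ℚ - 1) ^ p)) := by
  have h : PowerSeries.exp Poly - 1 =
      PowerSeries.map (MvPolynomial.C : ℚ →+* Poly) (PowerSeries.exp ℚ - 1) := by
    rw [map_sub, PowerSeries.map_exp, map_one]
  rw [expSubOne, ← map_pow, h, ← map_pow, PowerSeries.coeff_rescale, PowerSeries.coeff_map,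
    MvPolynomial.X_pow_eq_monomial, mul_comm, MvPolynomial.C_mul_monomial, mul_one]

theorem coeff_coeff_term (w h p k a b : ℕ) :
    MvPolynomial.coeff (expo w h p) (coeff (w + h)
      (PowerSeries.C (MvPolynomial.X 2) ^ k * (expSubOne 0 ^ a * expSubOne 1 ^ b))) =
    if k = p then coeff w ((PowerSeries.exp ℚ - 1) ^ a) * coeff h ((PowerSeries.exp ℚ - 1) ^ b)
    else 0 := by
  have hm : ∀ i j : ℕ, ∀ c d : ℚ, (MvPolynomial.X 2 : Poly) ^ k *
      (MvPolynomial.monomial (Finsupp.single 0 i) c * MvPolynomial.monomial (Finsupp.single 1 j) d)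
        = MvPolynomial.monomial (expo i j k) (c * d) := fun i j c d => by
    rw [MvPolynomial.X_pow_eq_monomial, MvPolynomial.monomial_mul, MvPolynomial.monomial_mul,
      one_mul, add_comm, expo]
  rw [← map_pow, PowerSeries.coeff_C_mul, PowerSeries.coeff_mul, Finset.mul_sum]
  simp only [coeff_expSubOne_pow, hm, MvPolynomial.coeff_sum, MvPolynomial.coeff_monomial,
    expo_inj]
  rw [Finset.sum_eq_single (w, h)]
  · simp
  · rintro ⟨i, j⟩ _ hij
    rw [if_neg]
    rintro ⟨rfl, rfl, _⟩
    exact hij rfl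
  · intro hn
    simp at hn

theorem coeff_coeff_tail (w h p k n : ℕ) (hk : p < k) (G : PowerSeries Poly) :
    MvPolynomial.coeff (expo w h p) (coeff n (PowerSeries.C (MvPolynomial.X 2) ^ k * G)) = 0 := by
  rw [← map_pow, PowerSeries.coeff_C_mul, MvPolynomial.X_pow_eq_monomial,
    MvPolynomial.coeff_monomial_mul', if_neg]
  rw [Finsupp.single_le_iff, expo_two]
  omega

theorem geom_eq (m : ℕ) :
    geom = ∑ k ∈ Finset.range m,
        (PowerSeries.C (MvPolynomial.X 2) * (expSubOne 0 * expSubOne 1)) ^ k +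
      (PowerSeries.C (MvPolynomial.X 2) * (expSubOne 0 * expSubOne 1)) ^ m * geom := by
  have e := mul_geom
  set r : PowerSeries Poly := PowerSeries.C (MvPolynomial.X 2) * (expSubOne 0 * expSubOne 1)
  linear_combination (∑ k ∈ Finset.range m, r ^ k) * e - geom * (mul_neg_geom_sum r m)

theorem expand_geom_sum {R : Type*} [CommRing R] {T A B D : R} {m : ℕ}
    (h : D = ∑ k ∈ Finset.range m, (T * (A * B)) ^ k + (T * (A * B)) ^ m * D) :
    (1 + T * A) * D =
      ∑ k ∈ Finset.range m, (T ^ k * (A ^ k * B ^ k) + T ^ (k + 1) * (A ^ (k + 1) * B ^ k)) +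
        T ^ m * ((A * B) ^ m * ((1 + T * A) * D)) := by
  have hs : ∑ k ∈ Finset.range m,
      (T ^ k * (A ^ k * B ^ k) + T ^ (k + 1) * (A ^ (k + 1) * B ^ k)) =
      (1 + T * A) * ∑ k ∈ Finset.range m, (T * (A * B)) ^ k := by
    rw [Finset.mul_sum]
    exact Finset.sum_congr rfl fun k _ => by ring
  rw [hs]
  linear_combination (1 + T * A) * h

theorem coeff_coeff_solution (w h p : ℕ) :
    MvPolynomial.coeff (expo w h (p + 1)) (coeff (w + h)
      ((1 + PowerSeries.C (MvPolynomial.X 2) * expSubOne 0) * geom)) =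
    coeff w ((PowerSeries.exp ℚ - 1) ^ (p + 1)) *
      (coeff h ((PowerSeries.exp ℚ - 1) ^ (p + 1)) + coeff h ((PowerSeries.exp ℚ - 1) ^ p)) := by
  have e : (1 + PowerSeries.C (MvPolynomial.X 2) * expSubOne 0) * geom =
      ∑ k ∈ Finset.range (p + 2),
        (PowerSeries.C (MvPolynomial.X 2) ^ k * (expSubOne 0 ^ k * expSubOne 1 ^ k) +
          PowerSeries.C (MvPolynomial.X 2) ^ (k + 1) *
            (expSubOne 0 ^ (k + 1) * expSubOne 1 ^ k)) +
      PowerSeries.C (MvPolynomial.X 2) ^ (p + 2) * ((expSubOne 0 * expSubOne 1) ^ (p + 2) *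
        ((1 + PowerSeries.C (MvPolynomial.X 2) * expSubOne 0) * geom)) := by
    exact expand_geom_sum (geom_eq (p + 2))
  rw [e, map_add, MvPolynomial.coeff_add, coeff_coeff_tail _ _ _ _ _ (Nat.lt_succ_self _),
    map_sum, MvPolynomial.coeff_sum]
  simp only [map_add, MvPolynomial.coeff_add, coeff_coeff_term, Finset.sum_add_distrib,
    add_left_inj, Finset.sum_ite_eq', Finset.mem_range]
  rw [if_pos (by omega), if_pos (by omega)]
  ring

theorem coeff_coeff_solution_eq (w h p : ℕ) :
    ((w + 1).factorial * h.factorial : ℚ) * MvPolynomial.coeff (expo (w + 1) h (p + 1))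
      (coeff (w + 1 + h) ((1 + PowerSeries.C (MvPolynomial.X 2) * expSubOne 0) * geom)) =
    p.factorial * (p + 1).factorial * stirling2 (w + 1) (p + 1) * stirling2 (h + 1) (p + 1) := by
  rw [coeff_coeff_solution]
  simp only [coeff_exp_sub_one_pow]
  rw [stirling2.eq_4 h p, Nat.factorial_succ p]
  push_cast
  field_simp

end HookSeries

theorem image_univ_sum {α β : Type*} [Fintype α] [Fintype β] (f : α ⊕ β → ℕ) :
    Finset.univ.image f =
      Finset.univ.image (f ∘ Sum.inl) ∪ Finset.univ.image (f ∘ Sum.inr) := by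
  ext n
  simp

section Labelling

variable {α β : Type*} [Fintype α] [DecidableEq α] [Fintype β] [DecidableEq β]

/-- The bijective labellings of `α` by the set `s` which decrease along `r`. -/
noncomputable def labellings (r : α → α → Prop) (s : Finset ℕ) : Finset (α → ℕ) :=
  @Finset.filter (α → ℕ)
    (fun f => Function.Injective f ∧ Finset.univ.image f = s ∧ ∀ u v, r u v → f v < f u)
    (Classical.decPred _) (Fintype.piFinset fun _ => s)

theorem mem_labellings {r : α → α → Prop} {s : Finset ℕ} {f : α → ℕ} :
    f ∈ labellings r s ↔
      Function.Injective f ∧ Finset.univ.image f = s ∧ ∀ u v, r u v → f v < f u := by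
  rw [labellings, @Finset.mem_filter _ _ (Classical.decPred _), Fintype.mem_piFinset,
    and_iff_right_iff_imp]
  rintro ⟨-, rfl, -⟩ a
  exact Finset.mem_image_of_mem f (Finset.mem_univ a)

theorem card_labellings_congr {r : α → α → Prop} {r' : β → β → Prop} (e : α ≃ β)
    (he : ∀ u v, r' (e u) (e v) ↔ r u v) (s : Finset ℕ) :
    (labellings r s).card = (labellings r' s).card := by
  refine Finset.card_nbij' (fun f => f ∘ e.symm) (fun g => g ∘ e) ?_ ?_ ?_ ?_
  · intro f hf
    obtain ⟨hi, hs, hr⟩ := mem_labellings.1 hf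
    refine mem_labellings.2 ⟨hi.comp e.symm.injective, ?_, fun u v huv => hr _ _ ?_⟩
    · rw [← Finset.image_image, Finset.image_univ_equiv, hs]
    · rw [← he, e.apply_symm_apply, e.apply_symm_apply]
      exact huv
  · intro f hf
    obtain ⟨hi, hs, hr⟩ := mem_labellings.1 hf
    refine mem_labellings.2 ⟨hi.comp e.injective, ?_, fun u v huv => hr _ _ ((he u v).2 huv)⟩
    rw [← Finset.image_image, Finset.image_univ_equiv, hs]
  · intro f _
    ext a
    simp
  · intro f _
    ext a
    simp

theorem card_labellings_range_card (r : α → α → Prop) (s : Finset ℕ) :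
    (labellings r s).card = (labellings r (Finset.range s.card)).card := by
  have hfin : (Set.ofPred (· ∈ s)).Finite := s.finite_toSet
  have hcard : hfin.toFinset.card = s.card := by
    congr 1
    ext a
    simp
  have hlt : ∀ n ∈ s, Nat.count (· ∈ s) n < s.card := fun n hn =>
    hcard ▸ Nat.count_lt_card hfin hn
  have hmem : ∀ n < s.card, Nat.nth (· ∈ s) n ∈ s := fun n hn =>
    Nat.nth_mem_of_lt_card hfin (hcard.symm ▸ hn)
  have hcn : ∀ n < s.card, Nat.count (· ∈ s) (Nat.nth (· ∈ s) n) = n := fun n hn =>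
    Nat.count_nth_of_lt_card_finite hfin (hcard.symm ▸ hn)
  have hnc : ∀ n ∈ s, Nat.nth (· ∈ s) (Nat.count (· ∈ s) n) = n := fun n hn => Nat.nth_count hn
  refine Finset.card_nbij' (fun f => Nat.count (· ∈ s) ∘ f) (fun g => Nat.nth (· ∈ s) ∘ g)
    ?_ ?_ ?_ ?_
  · intro f hf
    obtain ⟨hi, hs, hr⟩ := mem_labellings.1 hf
    have hm : ∀ a, f a ∈ s := fun a => hs ▸ Finset.mem_image_of_mem f (Finset.mem_univ a)
    refine mem_labellings.2 ⟨fun a b hab => hi ?_, ?_, fun u v huv => ?_⟩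
    · rw [← hnc _ (hm a), ← hnc _ (hm b)]
      exact congrArg _ hab
    · ext n
      rw [← Finset.image_image, hs, Finset.mem_image, Finset.mem_range]
      refine ⟨?_, fun hn => ⟨_, hmem n hn, hcn n hn⟩⟩
      rintro ⟨m, hm, rfl⟩
      exact hlt m hm
    · exact Nat.count_strict_mono (hm v) (hr u v huv)
  · intro g hg
    obtain ⟨hi, hs, hr⟩ := mem_labellings.1 hg
    have hm : ∀ a, g a < s.card := fun a =>
      Finset.mem_range.1 (hs ▸ Finset.mem_image_of_mem g (Finset.mem_univ a))
    refine mem_labellings.2 ⟨fun a b hab => hi ?_, ?_, fun u v huv => ?_⟩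
    · rw [← hcn _ (hm a), ← hcn _ (hm b)]
      exact congrArg _ hab
    · ext n
      rw [← Finset.image_image, hs, Finset.mem_image]
      refine ⟨?_, fun hn => ⟨_, Finset.mem_range.2 (hlt n hn), hnc n hn⟩⟩
      rintro ⟨m, hm, rfl⟩
      exact hmem m (Finset.mem_range.1 hm)
    · exact Nat.nth_lt_nth_of_lt_card hfin (hr u v huv) (hcard.symm ▸ hm u)
  · intro f hf
    ext a
    exact hnc _ ((mem_labellings.1 hf).2.1 ▸ Finset.mem_image_of_mem f (Finset.mem_univ a))
  · intro g hg
    ext a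
    exact hcn _ (Finset.mem_range.1
      ((mem_labellings.1 hg).2.1 ▸ Finset.mem_image_of_mem g (Finset.mem_univ a)))

theorem card_labellings_sum_fiber (r : α → α → Prop) (r' : β → β → Prop) {s t : Finset ℕ}
    (hts : t ⊆ s) :
    ((labellings (Sum.LiftRel r r') s).filter
      fun f => Finset.univ.image (f ∘ Sum.inl) = t).card =
    (labellings r t).card * (labellings r' (s \ t)).card := by
  rw [← Finset.card_product]
  refine Finset.card_nbij' (fun f => (f ∘ Sum.inl, f ∘ Sum.inr)) (fun g => Sum.elim g.1 g.2)
    ?_ ?_ ?_ ?_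
  · intro f hf
    obtain ⟨hf, ht⟩ := Finset.mem_filter.1 hf
    obtain ⟨hi, hs, hr⟩ := mem_labellings.1 hf
    refine Finset.mem_product.2 ⟨mem_labellings.2 ⟨hi.comp Sum.inl_injective, ht,
      fun u v huv => hr _ _ (Sum.LiftRel.inl huv)⟩, mem_labellings.2
      ⟨hi.comp Sum.inr_injective, ?_, fun u v huv => hr _ _ (Sum.LiftRel.inr huv)⟩⟩
    rw [← hs, image_univ_sum f, ht, Finset.union_sdiff_cancel_left]
    rw [← ht, Finset.disjoint_left]
    intro n hn hn'
    obtain ⟨a, -, rfl⟩ := Finset.mem_image.1 hn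
    obtain ⟨b, -, hb⟩ := Finset.mem_image.1 hn'
    exact absurd (hi hb) Sum.inr_ne_inl
  · rintro ⟨g, g'⟩ hg
    obtain ⟨hg, hg'⟩ := Finset.mem_product.1 hg
    obtain ⟨hi, hs, hr⟩ := mem_labellings.1 hg
    obtain ⟨hi', hs', hr'⟩ := mem_labellings.1 hg'
    refine Finset.mem_filter.2 ⟨mem_labellings.2 ⟨hi.sumElim hi' fun a b hab => ?_, ?_, ?_⟩, ?_⟩
    · have h1 : g a ∈ t := hs ▸ Finset.mem_image_of_mem g (Finset.mem_univ a)
      have h2 : g' b ∈ s \ t := hs' ▸ Finset.mem_image_of_mem g' (Finset.mem_univ b)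
      rw [← show g a = g' b from hab] at h2
      exact (Finset.mem_sdiff.1 h2).2 h1
    · rw [image_univ_sum]
      change Finset.univ.image g ∪ Finset.univ.image g' = s
      rw [hs, hs', Finset.union_sdiff_of_subset hts]
    · rintro _ _ (⟨h⟩ | ⟨h⟩)
      · exact hr _ _ h
      · exact hr' _ _ h
    · exact hs
  · intro f _
    exact Sum.elim_comp_inl_inr f
  · intro g _
    rfl

theorem card_labellings_sum (r : α → α → Prop) (r' : β → β → Prop) :
    (labellings (Sum.LiftRel r r') (Finset.range (Fintype.card α + Fintype.card β))).card =
      (Fintype.card α + Fintype.card β).choose (Fintype.card α) *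
        ((labellings r (Finset.range (Fintype.card α))).card *
          (labellings r' (Finset.range (Fintype.card β))).card) := by
  set s := Finset.range (Fintype.card α + Fintype.card β) with hs
  have hmaps : ∀ f ∈ labellings (Sum.LiftRel r r') s,
      Finset.univ.image (f ∘ Sum.inl) ∈ s.powersetCard (Fintype.card α) := by
    intro f hf
    obtain ⟨hi, hs, -⟩ := mem_labellings.1 hf
    refine Finset.mem_powersetCard.2 ⟨?_, ?_⟩
    · rw [← hs, image_univ_sum f]
      exact Finset.subset_union_left
    · rw [Finset.card_image_of_injective _ (hi.comp Sum.inl_injective), Finset.card_univ]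
  rw [Finset.card_eq_sum_card_fiberwise hmaps]
  have hcard : s.card = Fintype.card α + Fintype.card β := Finset.card_range _
  rw [← hcard, ← Finset.card_powersetCard, ← smul_eq_mul, ← Finset.sum_const]
  refine Finset.sum_congr rfl fun t ht => ?_
  obtain ⟨hts, htc⟩ := Finset.mem_powersetCard.1 ht
  rw [card_labellings_sum_fiber r r' hts, card_labellings_range_card r t,
    card_labellings_range_card r' (s \ t), Finset.card_sdiff_of_subset hts, htc, hcard,
    Nat.add_sub_cancel_left]

/-- The relation on `Option α` extending `r` by a top element `none`. -/
def topRel (r : α → α → Prop) : Option α → Option α → Prop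
  | none, none => False
  | none, some _ => True
  | some _, none => False
  | some a, some b => r a b

theorem card_labellings_option (r : α → α → Prop) :
    (labellings (topRel r) (Finset.range (Fintype.card α + 1))).card =
      (labellings r (Finset.range (Fintype.card α))).card := by
  have himage : ∀ f : Option α → ℕ,
      Finset.univ.image f = insert (f none) (Finset.univ.image (f ∘ some)) := by
    intro f
    ext n
    simp [Option.exists, eq_comm]
  have htop : ∀ f ∈ labellings (topRel r) (Finset.range (Fintype.card α + 1)),
      f none = Fintype.card α := by
    intro f hf
    obtain ⟨hi, hs, hr⟩ := mem_labellings.1 hf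
    have h1 : Fintype.card α ∈ Finset.univ.image f := hs ▸ Finset.self_mem_range_succ _
    have h2 : f none ∈ Finset.range (Fintype.card α + 1) :=
      hs ▸ Finset.mem_image_of_mem f (Finset.mem_univ _)
    obtain ⟨_ | a, -, ha⟩ := Finset.mem_image.1 h1
    · exact ha
    · have := hr none (some a) trivial
      rw [Finset.mem_range] at h2
      omega
  refine Finset.card_nbij' (fun f => f ∘ some)
    (fun g o => o.elim (Fintype.card α) g) ?_ ?_ ?_ ?_
  · intro f hf
    have ht := htop f hf
    obtain ⟨hi, hs, hr⟩ := mem_labellings.1 hf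
    refine mem_labellings.2 ⟨hi.comp (Option.some_injective _), ?_, fun u v huv => hr _ _ huv⟩
    rw [himage, ht, Finset.range_add_one] at hs
    have hn : Fintype.card α ∉ Finset.univ.image (f ∘ some) := by
      intro h
      obtain ⟨a, -, ha⟩ := Finset.mem_image.1 h
      exact absurd (hi (ha.trans ht.symm)) (Option.some_ne_none a)
    rw [← Finset.erase_insert hn, hs, Finset.erase_insert Finset.notMem_range_self]
  · intro g hg
    obtain ⟨hi, hs, hr⟩ := mem_labellings.1 hg
    have hm : ∀ a, g a < Fintype.card α := fun a =>
      Finset.mem_range.1 (hs ▸ Finset.mem_image_of_mem g (Finset.mem_univ a))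
    refine mem_labellings.2 ⟨?_, ?_, ?_⟩
    · rintro (_ | a) (_ | b) hab
      · rfl
      · exact absurd hab (hm b).ne'
      · exact absurd hab (hm a).ne
      · exact congrArg some (hi hab)
    · rw [himage, Finset.range_add_one, ← hs]
      rfl
    · rintro (_ | a) (_ | b) hab
      · exact hab.elim
      · exact hm b
      · exact hab.elim
      · exact hr _ _ hab
  · intro f hf
    ext (_ | a)
    · exact (htop f hf).symm
    · rfl
  · intro g _
    rfl

/-- The proportion of bijective labellings of `α` which decrease along `r`. -/
noncomputable def decRatio (r : α → α → Prop) : ℚ :=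
  (labellings r (Finset.range (Fintype.card α))).card / (Fintype.card α).factorial

theorem decRatio_congr {r : α → α → Prop} {r' : β → β → Prop} (e : α ≃ β)
    (he : ∀ u v, r' (e u) (e v) ↔ r u v) : decRatio r = decRatio r' := by
  rw [decRatio, decRatio, card_labellings_congr e he, Fintype.card_congr e]

theorem decRatio_sum (r : α → α → Prop) (r' : β → β → Prop) :
    decRatio (Sum.LiftRel r r') = decRatio r * decRatio r' := by
  rw [decRatio, decRatio, decRatio, Fintype.card_sum, card_labellings_sum, Nat.cast_mul,
    Nat.cast_mul, Nat.cast_add_choose]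
  field_simp

theorem decRatio_option (r : α → α → Prop) :
    decRatio (topRel r) = decRatio r / (Fintype.card α + 1) := by
  rw [decRatio, decRatio, Fintype.card_option, card_labellings_option, Nat.factorial_succ]
  push_cast
  field_simp

theorem decRatio_of_isEmpty [IsEmpty α] (r : α → α → Prop) : decRatio r = 1 := by
  have : labellings r (Finset.range (Fintype.card α)) = {isEmptyElim} := by
    ext f
    rw [mem_labellings, Finset.mem_singleton]
    refine ⟨fun _ => Subsingleton.elim _ _, fun _ => ⟨Function.injective_of_subsingleton f, ?_,
      fun u => isEmptyElim u⟩⟩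
    simp
  rw [decRatio, this]
  simp

end Labelling

namespace BT

/-- The vertices of `B` which are left children (for `b = false`) or right children (for
`b = true`). -/
def verts (b : Bool) (B : BT) : Finset (List Bool) :=
  B.paths.toFinset.filter (fun p => p.getLast? = some b)

/-- The left subtree (for `b = false`) or the right subtree (for `b = true`) of `node l r`. -/
def child : Bool → BT → BT → BT
  | false, l, _ => l
  | true, _, r => r

theorem mem_verts {b : Bool} {B : BT} {p : List Bool} :
    p ∈ verts b B ↔ p ∈ B.paths ∧ p.getLast? = some b := by
  simp [verts]

theorem cons_mem_paths_node {c : Bool} {q : List Bool} {l r : BT} :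
    c :: q ∈ (node l r).paths ↔ q ∈ (child c l r).paths := by
  cases c <;> simp [paths, child]

theorem nil_mem_paths {B : BT} (h : B ≠ nil) : [] ∈ B.paths := by
  cases B with
  | nil => exact absurd rfl h
  | node l r => simp [paths]

theorem nil_notMem_verts {b : Bool} {B : BT} : [] ∉ verts b B := by
  simp [mem_verts]

theorem cons_mem_verts_node {b c : Bool} {q : List Bool} {l r : BT} (hq : q ≠ []) :
    c :: q ∈ verts b (node l r) ↔ q ∈ verts b (child c l r) := by
  rw [mem_verts, mem_verts, cons_mem_paths_node, List.getLast?_cons_of_ne_nil hq]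

theorem singleton_mem_verts_node {b c : Bool} {l r : BT} :
    [c] ∈ verts b (node l r) ↔ [] ∈ (child c l r).paths ∧ c = b := by
  rw [mem_verts, cons_mem_paths_node]
  simp

theorem cons_mem_verts_node_of_mem {b c : Bool} {q : List Bool} {l r : BT}
    (hq : q ∈ verts b (child c l r)) : c :: q ∈ verts b (node l r) :=
  (cons_mem_verts_node fun h => nil_notMem_verts (h ▸ hq)).2 hq

/-- Strict ancestry between vertices of the same kind. -/
def anc (b : Bool) (B : BT) (u v : {p // p ∈ verts b B}) : Prop :=
  u.1 <+: v.1 ∧ u ≠ v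

/-- The vertices of one kind of `node l r`, when the subtree of this kind is nonempty. -/
def ofSum {b : Bool} {l r : BT} (hc : child b l r ≠ nil) :
    Option {p // p ∈ verts b (child b l r)} ⊕ {p // p ∈ verts b (child (!b) l r)} →
      {p // p ∈ verts b (node l r)}
  | Sum.inl none => ⟨[b], singleton_mem_verts_node.2 ⟨nil_mem_paths hc, rfl⟩⟩
  | Sum.inl (some q) => ⟨b :: q.1, cons_mem_verts_node_of_mem q.2⟩
  | Sum.inr q => ⟨(!b) :: q.1, cons_mem_verts_node_of_mem q.2⟩

theorem ne_nil_of_mem_verts {b : Bool} {B : BT} {q : List Bool} (h : q ∈ verts b B) : q ≠ [] :=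
  fun hq => nil_notMem_verts (hq ▸ h)

theorem ofSum_bijective {b : Bool} {l r : BT} (hc : child b l r ≠ nil) :
    Function.Bijective (ofSum hc) := by
  constructor
  · rintro ((_ | ⟨q, hq⟩) | ⟨q, hq⟩) ((_ | ⟨q', hq'⟩) | ⟨q', hq'⟩) h <;>
      have h := congrArg Subtype.val h <;> simp only [ofSum, List.cons.injEq] at h
    · rfl
    · exact absurd h.2.symm (ne_nil_of_mem_verts hq')
    · simp at h
    · exact absurd h.2 (ne_nil_of_mem_verts hq)
    · simp [h.2]
    · simp at h
    · simp at h
    · simp at h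
    · simp [h.2]
  · rintro ⟨_ | ⟨c, q⟩, hp⟩
    · exact absurd hp nil_notMem_verts
    · rcases eq_or_ne q [] with rfl | hq
      · obtain ⟨-, rfl⟩ := singleton_mem_verts_node.1 hp
        exact ⟨Sum.inl none, rfl⟩
      · have hq' := (cons_mem_verts_node hq).1 hp
        obtain rfl | rfl := Bool.eq_or_eq_not c b
        · exact ⟨Sum.inl (some ⟨q, hq'⟩), rfl⟩
        · exact ⟨Sum.inr ⟨q, hq'⟩, rfl⟩

theorem anc_ofSum {b : Bool} {l r : BT} (hc : child b l r ≠ nil)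
    (u v : Option {p // p ∈ verts b (child b l r)} ⊕ {p // p ∈ verts b (child (!b) l r)}) :
    anc b (node l r) (ofSum hc u) (ofSum hc v) ↔
      Sum.LiftRel (topRel (anc b (child b l r))) (anc b (child (!b) l r)) u v := by
  rw [anc, (ofSum_bijective hc).1.ne_iff]
  rcases u with (_ | ⟨q, hq⟩) | ⟨q, hq⟩ <;> rcases v with (_ | ⟨q', hq'⟩) | ⟨q', hq'⟩ <;>
    simp [ofSum, topRel, anc]
  exact fun h => absurd h (ne_nil_of_mem_verts hq)

/-- The vertices of one kind of `node l r`, when the subtree of this kind is empty. -/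
def ofChild (b : Bool) (l r : BT) (q : {p // p ∈ verts b (child (!b) l r)}) :
    {p // p ∈ verts b (node l r)} :=
  ⟨(!b) :: q.1, cons_mem_verts_node_of_mem q.2⟩

theorem ofChild_bijective {b : Bool} {l r : BT} (hc : child b l r = nil) :
    Function.Bijective (ofChild b l r) := by
  constructor
  · rintro ⟨q, hq⟩ ⟨q', hq'⟩ h
    simpa [ofChild] using h
  · rintro ⟨_ | ⟨c, q⟩, hp⟩
    · exact absurd hp nil_notMem_verts
    · have hq := cons_mem_paths_node.1 (mem_verts.1 hp).1
      obtain rfl | rfl := Bool.eq_or_eq_not c b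
      · rw [hc] at hq
        simp [paths] at hq
      · rcases eq_or_ne q [] with rfl | hq
        · simpa using singleton_mem_verts_node.1 hp
        · exact ⟨⟨q, (cons_mem_verts_node hq).1 hp⟩, rfl⟩

theorem anc_ofChild {b : Bool} {l r : BT} (hc : child b l r = nil)
    (u v : {p // p ∈ verts b (child (!b) l r)}) :
    anc b (node l r) (ofChild b l r u) (ofChild b l r v) ↔ anc b (child (!b) l r) u v := by
  rw [anc, anc, (ofChild_bijective hc).1.ne_iff]
  simp [ofChild]

/-- The number of vertices of one kind, the root of a nonempty tree being included. -/
def aug (b : Bool) (B : BT) : ℕ :=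
  if B = nil then 0 else (verts b B).card + 1

/-- The proportion of the bijective labellings of the vertices of one kind which decrease along
ancestry. -/
noncomputable def ratio (b : Bool) (B : BT) : ℚ :=
  decRatio (anc b B)

/-- The analogue of `ratio` where the root of a nonempty tree is included. -/
noncomputable def ratioAug (b : Bool) (B : BT) : ℚ :=
  if B = nil then 1 else ratio b B / ((verts b B).card + 1)

theorem card_verts_node (b : Bool) (l r : BT) :
    (verts b (node l r)).card = aug b (child b l r) + (verts b (child (!b) l r)).card := by
  by_cases hc : child b l r = nil
  · rw [aug, if_pos hc, zero_add, ← Fintype.card_coe, ← Fintype.card_coe]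
    exact (Fintype.card_of_bijective (ofChild_bijective hc)).symm
  · rw [aug, if_neg hc, ← Fintype.card_coe, ← Fintype.card_coe, ← Fintype.card_coe,
      ← Fintype.card_of_bijective (ofSum_bijective hc), Fintype.card_sum, Fintype.card_option]

theorem ratio_node (b : Bool) (l r : BT) :
    ratio b (node l r) = ratioAug b (child b l r) * ratio b (child (!b) l r) := by
  by_cases hc : child b l r = nil
  · rw [ratioAug, if_pos hc, one_mul, ratio, ratio]
    exact (decRatio_congr (Equiv.ofBijective _ (ofChild_bijective hc)) (anc_ofChild hc)).symm
  · rw [ratioAug, if_neg hc, ratio,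
      ← decRatio_congr (Equiv.ofBijective _ (ofSum_bijective hc)) (anc_ofSum hc),
      decRatio_sum, decRatio_option, Fintype.card_coe, ratio, ratio]

theorem verts_nil (b : Bool) : verts b nil = ∅ := rfl

theorem ratio_nil (b : Bool) : ratio b nil = 1 := by
  have : IsEmpty {p // p ∈ verts b nil} := ⟨fun p => Finset.notMem_empty _ p.2⟩
  exact decRatio_of_isEmpty _

theorem size_node (l r : BT) : (node l r).size = l.size + r.size + 1 := by
  simp [size, paths]

theorem aug_add_card_verts (b : Bool) (B : BT) :
    aug b B + (verts (!b) B).card = B.size := by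
  induction B generalizing b with
  | nil => simp [aug, verts_nil, size, paths]
  | node l r ihl ihr =>
    have h1 := ihl false
    have h2 := ihr true
    rw [aug, if_neg (by simp), size_node, card_verts_node, card_verts_node]
    cases b <;> simp only [Bool.not_true, Bool.not_false, child] at * <;> omega

/-- The finite set of binary trees with `n` vertices. -/
def treesOfSize : ℕ → Finset BT
  | 0 => {nil}
  | n + 1 =>
    (Finset.HasAntidiagonal.antidiagonal n).attach.biUnion fun ij =>
      (treesOfSize ij.1.1 ×ˢ treesOfSize ij.1.2).image fun lr => node lr.1 lr.2
  decreasing_by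
    · have := Finset.HasAntidiagonal.mem_antidiagonal.1 ij.2; omega
    · have := Finset.HasAntidiagonal.mem_antidiagonal.1 ij.2; omega

theorem mem_treesOfSize {B : BT} {n : ℕ} : B ∈ treesOfSize n ↔ B.size = n := by
  induction B generalizing n with
  | nil => cases n <;> simp [treesOfSize, size, paths]
  | node l r ihl ihr =>
    rw [size_node]
    cases n with
    | zero => simp [treesOfSize]
    | succ n => simp [treesOfSize, ihl, ihr]

theorem sum_treesOfSize_succ {M : Type*} [AddCommMonoid M] (f : BT → M) (n : ℕ) :
    ∑ B ∈ treesOfSize (n + 1), f B =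
      ∑ ij ∈ Finset.HasAntidiagonal.antidiagonal n, ∑ l ∈ treesOfSize ij.1, ∑ r ∈ treesOfSize ij.2,
        f (node l r) := by
  simp only [← Finset.sum_product']
  rw [Finset.sum_sigma']
  symm
  refine Finset.sum_bij (fun x _ => node x.2.1 x.2.2) ?_ ?_ ?_ ?_
  · rintro ⟨⟨i, j⟩, l, r⟩ h
    simp only [Finset.mem_sigma, Finset.HasAntidiagonal.mem_antidiagonal, Finset.mem_product,
      mem_treesOfSize] at h
    rw [mem_treesOfSize, size_node, h.2.1, h.2.2, h.1]
  · rintro ⟨⟨i, j⟩, l, r⟩ h ⟨⟨i', j'⟩, l', r'⟩ h' e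
    simp only [Finset.mem_sigma, Finset.HasAntidiagonal.mem_antidiagonal, Finset.mem_product,
      mem_treesOfSize] at h h'
    simp only [node.injEq] at e
    obtain ⟨rfl, rfl⟩ := e
    obtain ⟨-, rfl, rfl⟩ := h
    obtain ⟨-, rfl, rfl⟩ := h'
    rfl
  · rintro (_ | ⟨l, r⟩) h
    · simp [mem_treesOfSize, size, paths] at h
    · rw [mem_treesOfSize, size_node] at h
      refine ⟨⟨(l.size, r.size), l, r⟩, ?_, rfl⟩
      simp only [Finset.mem_sigma, Finset.HasAntidiagonal.mem_antidiagonal, Finset.mem_product,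
        mem_treesOfSize]
      exact ⟨by omega, trivial, trivial⟩
  · intro _ _
    rfl

end BT

theorem finite_nat (B : BT) : Finite (NAT B) := by
  refine Finite.of_injective (fun T : NAT B => (T.fL, T.fR)) ?_
  rintro ⟨⟩ ⟨⟩ h
  simpa using h

theorem natCard_nat (B : BT) :
    (Nat.card (NAT B) : ℚ) =
      B.leftVertices.card.factorial * B.rightVertices.card.factorial *
        (BT.ratio false B * BT.ratio true B) := by
  have hm : ∀ (b : Bool) (f : {p // p ∈ BT.verts b B} → ℕ),
      f ∈ labellings (BT.anc b B) (Finset.range (BT.verts b B).card) → ∀ u,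
      f u < (BT.verts b B).card := fun b f hf u => by
    rw [← Finset.mem_range, ← (mem_labellings.1 hf).2.1]
    exact Finset.mem_image_of_mem f (Finset.mem_univ u)
  have hmem : ∀ (b : Bool) (f : {p // p ∈ BT.verts b B} → Fin (BT.verts b B).card),
      f.Bijective → (∀ u v, u.1 <+: v.1 → u ≠ v → (f v : ℕ) < f u) →
      (fun u => (f u : ℕ)) ∈ labellings (BT.anc b B) (Finset.range (BT.verts b B).card) := by
    intro b f hf ha
    refine mem_labellings.2 ⟨Fin.val_injective.comp hf.1, ?_, fun u v h => ha u v h.1 h.2⟩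
    ext n
    simp only [Finset.mem_image, Finset.mem_univ, true_and, Finset.mem_range]
    refine ⟨?_, fun hn => ?_⟩
    · rintro ⟨u, rfl⟩
      exact (f u).2
    · obtain ⟨u, hu⟩ := hf.2 ⟨n, hn⟩
      exact ⟨u, congrArg Fin.val hu⟩
  have hbij : ∀ (b : Bool) (f : {p // p ∈ BT.verts b B} → ℕ)
      (hf : f ∈ labellings (BT.anc b B) (Finset.range (BT.verts b B).card)),
      Function.Bijective fun u => (⟨f u, hm b f hf u⟩ : Fin (BT.verts b B).card) := by
    intro b f hf
    refine (Fintype.bijective_iff_injective_and_card _).2 ⟨fun u v h => ?_, by simp⟩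
    exact (mem_labellings.1 hf).1 (congrArg Fin.val h)
  let e : NAT B ≃ labellings (BT.anc false B) (Finset.range (BT.verts false B).card) ×
      labellings (BT.anc true B) (Finset.range (BT.verts true B).card) :=
    { toFun := fun T => (⟨_, hmem false T.fL T.bijL T.ancL⟩, ⟨_, hmem true T.fR T.bijR T.ancR⟩)
      invFun := fun f =>
        { fL := fun u => ⟨f.1.1 u, hm false _ f.1.2 u⟩
          fR := fun u => ⟨f.2.1 u, hm true _ f.2.2 u⟩
          bijL := hbij false _ f.1.2
          bijR := hbij true _ f.2.2
          ancL := fun u v h h' => (mem_labellings.1 f.1.2).2.2 u v ⟨h, h'⟩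
          ancR := fun u v h h' => (mem_labellings.1 f.2.2).2.2 u v ⟨h, h'⟩ }
      left_inv := fun T => rfl
      right_inv := fun f => rfl }
  rw [Nat.card_congr e, Nat.card_prod, Nat.card_eq_fintype_card, Nat.card_eq_fintype_card,
    Fintype.card_coe, Fintype.card_coe, BT.ratio, BT.ratio, decRatio, decRatio,
    Fintype.card_coe, Fintype.card_coe]
  change _ = ((BT.verts false B).card.factorial * (BT.verts true B).card.factorial : ℚ) * _
  push_cast
  field_simp

namespace HookSeries

open PowerSeries (coeff)
open BT (verts aug ratio ratioAug treesOfSize)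

/-- The generating series, by number of vertices, of the weights `m B` of binary trees. -/
noncomputable def genSeries (m : BT → Poly) : PowerSeries Poly :=
  PowerSeries.mk fun n => ∑ B ∈ treesOfSize n, m B

theorem coeff_zero_genSeries (m : BT → Poly) : coeff 0 (genSeries m) = m BT.nil := by
  simp [genSeries, treesOfSize]

theorem coeff_succ_genSeries (m : BT → Poly) (n : ℕ) :
    coeff (n + 1) (genSeries m) =
      ∑ ij ∈ Finset.HasAntidiagonal.antidiagonal n, ∑ l ∈ treesOfSize ij.1,
        ∑ r ∈ treesOfSize ij.2, m (BT.node l r) := by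
  rw [genSeries, PowerSeries.coeff_mk, BT.sum_treesOfSize_succ]

theorem pd_genSeries {i : Fin 3} {m m₁ m₂ : BT → Poly} (h0 : m BT.nil = 1)
    (h : ∀ l r, MvPolynomial.pderiv i (m (BT.node l r)) = m₁ l * m₂ r) :
    pd i (genSeries m) = PowerSeries.X * (genSeries m₁ * genSeries m₂) := by
  ext1 n
  rw [coeff_pd]
  cases n with
  | zero => rw [coeff_zero_genSeries, h0, PowerSeries.coeff_zero_X_mul, MvPolynomial.pderiv_one]
  | succ n =>
    rw [coeff_succ_genSeries, PowerSeries.coeff_succ_X_mul, PowerSeries.coeff_mul, map_sum]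
    refine Finset.sum_congr rfl fun ij _ => ?_
    simp only [map_sum, h, genSeries, PowerSeries.coeff_mk, Finset.sum_mul_sum]

theorem C_mul_genSeries (a : Poly) (m : BT → Poly) :
    PowerSeries.C a * genSeries m = genSeries fun B => a * m B := by
  ext1 n
  simp [genSeries, Finset.mul_sum]

theorem map_kill_genSeries {i : Fin 3} {m : BT → Poly} (h0 : m BT.nil = 1)
    (h : ∀ l r, kill i (m (BT.node l r)) = 0) :
    PowerSeries.map (kill i : Poly →+* Poly) (genSeries m) = 1 := by
  ext1 n
  rw [PowerSeries.coeff_map]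
  cases n with
  | zero => rw [coeff_zero_genSeries, h0, map_one, PowerSeries.coeff_zero_one]
  | succ n =>
    rw [coeff_succ_genSeries, PowerSeries.coeff_one, if_neg (Nat.succ_ne_zero n)]
    simp only [map_sum, RingHom.coe_coe, h, Finset.sum_const_zero]

/-- The weight of `B` seen as a left subtree on a left spine. -/
noncomputable def weightP (B : BT) : Poly :=
  MvPolynomial.monomial (expo (aug false B) (verts true B).card B.hookNumL)
    (ratioAug false B * ratio true B)

/-- The weight of `B` seen as a right subtree on a right spine. -/
noncomputable def weightQ (B : BT) : Poly :=
  MvPolynomial.monomial (expo (verts false B).card (aug true B) B.hookNumR)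
    (ratio false B * ratioAug true B)

/-- The weight of `B` seen as a left subtree whose root starts a new hook. -/
noncomputable def weightU (B : BT) : Poly :=
  MvPolynomial.monomial (expo (aug false B) (verts true B).card B.hookNum)
    (ratioAug false B * ratio true B)

/-- The weight of `B` seen as a right subtree whose root starts a new hook. -/
noncomputable def weightV (B : BT) : Poly :=
  MvPolynomial.monomial (expo (verts false B).card (aug true B) B.hookNum)
    (ratio false B * ratioAug true B)

theorem aug_nil (b : Bool) : aug b BT.nil = 0 := if_pos rfl

theorem ratioAug_nil (b : Bool) : ratioAug b BT.nil = 1 := if_pos rfl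

theorem aug_node (b : Bool) (l r : BT) :
    aug b (BT.node l r) = (verts b (BT.node l r)).card + 1 := if_neg (by simp)

theorem ratioAug_node (b : Bool) (l r : BT) :
    ratioAug b (BT.node l r) = ratio b (BT.node l r) / ((verts b (BT.node l r)).card + 1) :=
  if_neg (by simp)

theorem pderiv_zero_monomial (i j k : ℕ) (c d : ℚ) :
    MvPolynomial.pderiv 0 (MvPolynomial.monomial (expo (i + 1) j k) (c / (i + 1) * d)) =
      MvPolynomial.monomial (expo i j k) (c * d) := by
  have h : expo (i + 1) j k = expo i j k + Finsupp.single 0 1 := by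
    simp only [expo, Finsupp.single_add]
    abel
  rw [MvPolynomial.pderiv_monomial, expo_zero, h, add_tsub_cancel_right]
  push_cast
  congr 1
  field_simp

theorem pderiv_one_monomial (i j k : ℕ) (c d : ℚ) :
    MvPolynomial.pderiv 1 (MvPolynomial.monomial (expo i (j + 1) k) (c * (d / (j + 1)))) =
      MvPolynomial.monomial (expo i j k) (c * d) := by
  have h : expo i (j + 1) k = expo i j k + Finsupp.single 1 1 := by
    simp only [expo, Finsupp.single_add]
    abel
  rw [MvPolynomial.pderiv_monomial, expo_one, h, add_tsub_cancel_right]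
  push_cast
  congr 1
  field_simp

theorem isSolution_genSeries :
    IsSolution (genSeries weightP) (genSeries weightQ) (genSeries weightU)
      (genSeries weightV) := by
  have hexpo : expo 0 0 0 = 0 := by simp [expo]
  have hX : (MvPolynomial.X 2 : Poly) = MvPolynomial.monomial (expo 0 0 1) 1 := by
    simp [expo, MvPolynomial.X]
  have P0 : weightP BT.nil = 1 := by
    simp [weightP, aug_nil, ratioAug_nil, BT.ratio_nil, BT.verts_nil, BT.hookNumL, hexpo]
  have Q0 : weightQ BT.nil = 1 := by
    simp [weightQ, aug_nil, ratioAug_nil, BT.ratio_nil, BT.verts_nil, BT.hookNumR, hexpo]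
  have U0 : weightU BT.nil = 1 := by
    simp [weightU, aug_nil, ratioAug_nil, BT.ratio_nil, BT.verts_nil, BT.hookNum, hexpo]
  have V0 : weightV BT.nil = 1 := by
    simp [weightV, aug_nil, ratioAug_nil, BT.ratio_nil, BT.verts_nil, BT.hookNum, hexpo]
  have mono_congr : ∀ {i j k i' j' k' : ℕ} {c c' : ℚ}, i = i' → j = j' → k = k' → c = c' →
      (MvPolynomial.monomial (expo i j k) c : Poly) =
        MvPolynomial.monomial (expo i' j' k') c' := by
    rintro _ _ _ _ _ _ _ _ rfl rfl rfl rfl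
    rfl
  constructor
  · refine pd_genSeries P0 fun l r => ?_
    rw [weightP, aug_node, ratioAug_node, pderiv_zero_monomial, weightP, weightV,
      MvPolynomial.monomial_mul, expo_add, BT.card_verts_node, BT.card_verts_node,
      BT.ratio_node, BT.ratio_node, BT.hookNumL]
    simp only [BT.child, Bool.not_true, Bool.not_false]
    exact mono_congr rfl (add_comm _ _) rfl (by ring)
  · refine pd_genSeries Q0 fun l r => ?_
    rw [weightQ, aug_node, ratioAug_node, pderiv_one_monomial, weightU, weightQ,
      MvPolynomial.monomial_mul, expo_add, BT.card_verts_node, BT.card_verts_node,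
      BT.ratio_node, BT.ratio_node, BT.hookNumR]
    simp only [BT.child, Bool.not_true, Bool.not_false]
    exact mono_congr rfl (add_comm _ _) rfl (by ring)
  · rw [← mul_assoc (PowerSeries.C _), C_mul_genSeries]
    refine pd_genSeries U0 fun l r => ?_
    rw [weightU, aug_node, ratioAug_node, pderiv_zero_monomial, weightP, weightQ, hX,
      MvPolynomial.monomial_mul, MvPolynomial.monomial_mul, expo_add, expo_add,
      BT.card_verts_node, BT.card_verts_node, BT.ratio_node, BT.ratio_node, BT.hookNum]
    simp only [BT.child, Bool.not_true, Bool.not_false]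
    exact mono_congr (by omega) (by omega) rfl (by ring)
  · rw [← mul_assoc (PowerSeries.C _), C_mul_genSeries]
    refine pd_genSeries V0 fun l r => ?_
    rw [weightV, aug_node, ratioAug_node, pderiv_one_monomial, weightP, weightQ, hX,
      MvPolynomial.monomial_mul, MvPolynomial.monomial_mul, expo_add, expo_add,
      BT.card_verts_node, BT.card_verts_node, BT.ratio_node, BT.ratio_node, BT.hookNum]
    simp only [BT.child, Bool.not_true, Bool.not_false]
    exact mono_congr (by omega) (by omega) rfl (by ring)
  · refine map_kill_genSeries P0 fun l r => ?_
    rw [weightP, kill_monomial, expo_zero, aug_node, if_neg (Nat.succ_ne_zero _)]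
  · refine map_kill_genSeries Q0 fun l r => ?_
    rw [weightQ, kill_monomial, expo_one, aug_node, if_neg (Nat.succ_ne_zero _)]
  · refine map_kill_genSeries U0 fun l r => ?_
    rw [weightU, kill_monomial, expo_zero, aug_node, if_neg (Nat.succ_ne_zero _)]
  · refine map_kill_genSeries V0 fun l r => ?_
    rw [weightV, kill_monomial, expo_one, aug_node, if_neg (Nat.succ_ne_zero _)]

theorem sum_ratio_eq (w h p : ℕ) :
    ∑ B ∈ (treesOfSize (w + 1 + h)).filter fun B =>
        B ≠ BT.nil ∧ (verts false B).card = w ∧ (verts true B).card = h ∧ B.hookNum = p + 1,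
      (w.factorial * h.factorial : ℚ) * (ratio false B * ratio true B) =
    p.factorial * (p + 1).factorial * stirling2 (w + 1) (p + 1) * stirling2 (h + 1) (p + 1) := by
  rw [← coeff_coeff_solution_eq, ← isSolution_genSeries.unique isSolution_geom, genSeries,
    PowerSeries.coeff_mk, MvPolynomial.coeff_sum, Finset.mul_sum, Finset.sum_filter]
  refine Finset.sum_congr rfl fun B hB => ?_
  rw [weightU, MvPolynomial.coeff_monomial]
  rcases B with _ | ⟨l, r⟩
  · rw [if_neg (by simp), if_neg, mul_zero]
    rw [expo_inj, aug_nil]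
    omega
  · have hiff : (BT.node l r ≠ BT.nil ∧ (verts false (BT.node l r)).card = w ∧
        (verts true (BT.node l r)).card = h ∧ (BT.node l r).hookNum = p + 1) ↔
        expo (aug false (BT.node l r)) (verts true (BT.node l r)).card (BT.node l r).hookNum =
          expo (w + 1) h (p + 1) := by
      rw [expo_inj, aug_node, Nat.add_right_cancel_iff, and_iff_right (by simp)]
    by_cases hc : expo (aug false (BT.node l r)) (verts true (BT.node l r)).card
        (BT.node l r).hookNum = expo (w + 1) h (p + 1)
    · rw [if_pos hc, if_pos (hiff.2 hc), ratioAug_node, (hiff.2 hc).2.1, Nat.factorial_succ]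
      push_cast
      field_simp
    · rw [if_neg hc, if_neg (mt hiff.1 hc), mul_zero]

end HookSeries


/-- The number of non-ambiguous trees with `w` left children, `h` right
children and hook number `p ≥ 1` is `(p−1)! · p! · S(w+1,p) · S(h+1,p)`. -/
theorem natCount_hookNum_eq (w h p : ℕ) (hp : 1 ≤ p) :
    Nat.card {T : Σ B : BT, NAT B //
        T.1 ≠ BT.nil ∧ T.1.leftVertices.card = w ∧ T.1.rightVertices.card = h ∧
          T.1.hookNum = p} =
      (p - 1).factorial * p.factorial * stirling2 (w + 1) p * stirling2 (h + 1) p := by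
  obtain ⟨p, rfl⟩ : ∃ q, p = q + 1 := ⟨p - 1, by omega⟩
  set c : BT → Prop := fun B => B ≠ BT.nil ∧ B.leftVertices.card = w ∧
    B.rightVertices.card = h ∧ B.hookNum = p + 1 with hc
  have hsize : ∀ B, c B ↔ B ∈ (BT.treesOfSize (w + 1 + h)).filter c := fun B => by
    rw [Finset.mem_filter, BT.mem_treesOfSize, iff_and_self]
    rintro ⟨hB, rfl, rfl, -⟩
    rw [← BT.aug_add_card_verts false, BT.aug, if_neg hB]
    rfl
  have hfin : ∀ B, Finite (NAT B) := finite_nat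
  let e : {T : Σ B : BT, NAT B // c T.1} ≃
      Σ B : {B // B ∈ (BT.treesOfSize (w + 1 + h)).filter c}, NAT B.1 :=
    { toFun := fun T => ⟨⟨T.1.1, (hsize _).1 T.2⟩, T.1.2⟩
      invFun := fun T => ⟨⟨T.1.1, T.2⟩, (hsize _).2 T.1.2⟩
      left_inv := fun _ => rfl
      right_inv := fun _ => rfl }
  rw [Nat.card_congr e, Nat.card_sigma,
    Finset.sum_coe_sort ((BT.treesOfSize (w + 1 + h)).filter c) fun B => Nat.card (NAT B)]
  have hsum : ∑ B ∈ (BT.treesOfSize (w + 1 + h)).filter c, (Nat.card (NAT B) : ℚ) =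
      ∑ B ∈ (BT.treesOfSize (w + 1 + h)).filter c,
        (w.factorial * h.factorial : ℚ) * (BT.ratio false B * BT.ratio true B) := by
    refine Finset.sum_congr rfl fun B hB => ?_
    obtain ⟨-, hw, hh, -⟩ := (hsize B).2 hB
    rw [natCard_nat, hw, hh]
  rw [Nat.add_sub_cancel]
  exact_mod_cast hsum.trans (HookSeries.sum_ratio_eq w h p)
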